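/- arXiv:0902.4452 — 2 statements merged into one kernel-verified Lean document; each statement's English description precedes it below -/
import Mathlib

section
/- Let m ≥ 1 and let LL(w) = -log|log|w|| for w ∈ ℂ^m with 0 < |w| < 1 (Euclidean norm). Then there exists r ∈ (0,1) such that for every w with 0 < |w| < r and every vector t ∈ ℂ^m, the function ζ ↦ LL(w + ζt), defined for ζ ∈ ℂ near 0, satisfies Δ_ζ [LL(w + ζt)] |_{ζ=0} ≥ |t|² / (|w|² (log|w|)²), where Δ_ζ is the Laplacian in the real and imaginary parts of ζ. (Equivalently, the complex Hessian of LL satisfies 4 Σ_{j,k} (∂²LL/∂w_j∂w̄_k)(w) t_j t̄_k ≥ |t|²/(|w|² log²|w|).) -/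
/-- The Laplacian of `f : ℂ → ℝ`: `Δf = ∂²f/∂x² + ∂²f/∂y²`, expressed via second
directional derivatives in the directions `1` and `I`. -/
noncomputable def lapR (f : ℂ → ℝ) (z : ℂ) : ℝ :=
  fderiv ℝ (fun w => fderiv ℝ f w 1) z 1 +
    fderiv ℝ (fun w => fderiv ℝ f w Complex.I) z Complex.I

open Complex in
/-- The derivative of `z ↦ W + 2 Re (z p) + T |z|²`. -/
theorem hasFDerivAt_quadratic (W T : ℝ) (p z : ℂ) :
    HasFDerivAt (fun z : ℂ => W + 2 * (z.re * p.re - z.im * p.im) + T * (z.re ^ 2 + z.im ^ 2))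
      ((2 * p.re + 2 * T * z.re) • reCLM + (-2 * p.im + 2 * T * z.im) • imCLM) z := by
  have hre : HasFDerivAt (fun z : ℂ => z.re) reCLM z := reCLM.hasFDerivAt
  have him : HasFDerivAt (fun z : ℂ => z.im) imCLM z := imCLM.hasFDerivAt
  have h := ((((hre.mul_const p.re).sub (him.mul_const p.im)).const_mul 2).const_add W).add
    (((hre.pow 2).add (him.pow 2)).const_mul T)
  refine h.congr_fderiv ?_
  ext
  all_goals simp
  all_goals ring

open Complex in
/-- Second directional derivative of `-log (log Q / 2)` at `0` for `Q z = W + 2 Re (z p) + T |z|²`. -/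
theorem fderiv_fderiv_neg_log_log_quadratic {W : ℝ} (T : ℝ) (p v : ℂ) (hW : 0 < W) (hW1 : W < 1) :
    fderiv ℝ (fun z => fderiv ℝ (fun z : ℂ => -Real.log (Real.log
        (W + 2 * (z.re * p.re - z.im * p.im) + T * (z.re ^ 2 + z.im ^ 2)) / 2)) z v) 0 v =
      (1 + Real.log W) * (2 * p.re * v.re - 2 * p.im * v.im) ^ 2 / (Real.log W * W) ^ 2
        - 2 * T * (v.re ^ 2 + v.im ^ 2) / (Real.log W * W) := by
  set Q : ℂ → ℝ := fun z => W + 2 * (z.re * p.re - z.im * p.im) + T * (z.re ^ 2 + z.im ^ 2)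
    with hQ
  have hQ0 : Q 0 = W := by simp [hQ]
  have hQc : Continuous Q := by fun_prop
  have hlog : Real.log W < 0 := Real.log_neg hW hW1
  have hfirst : (fun z => fderiv ℝ (fun z => -Real.log (Real.log (Q z) / 2)) z v) =ᶠ[nhds 0]
      fun z => -((Real.log (Q z) * Q z)⁻¹ *
        ((2 * p.re + 2 * T * z.re) * v.re + (-2 * p.im + 2 * T * z.im) * v.im)) := by
    have hev : ∀ᶠ z in nhds 0, Q z ∈ Set.Ioo 0 1 :=
      hQc.continuousAt.eventually_mem (Ioo_mem_nhds (by rwa [hQ0]) (by rwa [hQ0]))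
    filter_upwards [hev] with z hz
    have hne : Real.log (Q z) ≠ 0 := (Real.log_neg hz.1 hz.2).ne
    have hz0 : Q z ≠ 0 := hz.1.ne'
    have h := ((((hasFDerivAt_quadratic W T p z).log hz0).mul_const (1 / 2)).log
      (mul_ne_zero hne (by norm_num))).neg
    simp only [mul_one_div] at h
    refine (congrArg (fun A : ℂ →L[ℝ] ℝ => A v) h.fderiv).trans ?_
    simp only [hQ] at hne hz0 ⊢
    simp
    field_simp
    ring
  rw [hfirst.fderiv_eq]
  have hQd := hasFDerivAt_quadratic W T p 0
  have hre : HasFDerivAt (fun z : ℂ => z.re) reCLM 0 := reCLM.hasFDerivAt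
  have him : HasFDerivAt (fun z : ℂ => z.im) imCLM 0 := imCLM.hasFDerivAt
  have hB := ((((hre.const_mul (2 * T)).const_add (2 * p.re)).mul_const v.re).add
    (((him.const_mul (2 * T)).const_add (-2 * p.im)).mul_const v.im))
  have hL := (hQd.log (show Q 0 ≠ 0 by rw [hQ0]; exact hW.ne')).mul hQd
  have hI := (hasDerivAt_inv (show Real.log (Q 0) * Q 0 ≠ 0 by
    rw [hQ0]; exact mul_ne_zero hlog.ne hW.ne')).comp_hasFDerivAt (0 : ℂ) hL
  have h := (hI.mul hB).neg
  refine (congrArg (fun A : ℂ →L[ℝ] ℝ => A v) h.fderiv).trans ?_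
  have := hlog.ne
  have := hW.ne'
  simp [hQ0]
  field_simp
  ring

/-- Expansion of `‖w + ζ t‖²` in the real and imaginary parts of `ζ`. -/
theorem norm_add_smul_sq_eq {E : Type*} [NormedAddCommGroup E] [InnerProductSpace ℂ E]
    (w t : E) (z : ℂ) :
    ‖w + z • t‖ ^ 2 = ‖w‖ ^ 2 + 2 * (z.re * (inner ℂ w t).re - z.im * (inner ℂ w t).im)
      + ‖t‖ ^ 2 * (z.re ^ 2 + z.im ^ 2) := by
  rw [@norm_add_sq ℂ, inner_smul_right, norm_smul, mul_pow, Complex.sq_norm, Complex.normSq_apply]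
  simp
  ring

/-- For `LL(w) = -log|log|w||` on `ℂ^m` there is `r ∈ (0,1)` such that for `0 < |w| < r`
and any `t ∈ ℂ^m`, `Δ_ζ [LL(w + ζt)] |_{ζ=0} ≥ |t|²/(|w|² (log|w|)²)`. -/
theorem stmt8 (m : ℕ) (hm : 1 ≤ m) :
    ∃ r ∈ Set.Ioo (0 : ℝ) 1,
      ∀ w : EuclideanSpace ℂ (Fin m), 0 < ‖w‖ → ‖w‖ < r →
        ∀ t : EuclideanSpace ℂ (Fin m),
          ‖t‖ ^ 2 / (‖w‖ ^ 2 * (Real.log ‖w‖) ^ 2)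
            ≤ lapR (fun ζ : ℂ => -Real.log |Real.log ‖w + ζ • t‖|) 0 := by
  refine ⟨Real.exp (-1), ⟨Real.exp_pos _, Real.exp_lt_one_iff.2 (by norm_num)⟩, ?_⟩
  intro w hw hwr t
  have hl : Real.log ‖w‖ < -1 := (Real.log_lt_iff_lt_exp hw).2 hwr
  have hw1 : ‖w‖ ^ 2 < 1 :=
    pow_lt_one₀ hw.le (hwr.trans (Real.exp_lt_one_iff.2 (by norm_num))) two_ne_zero
  set p : ℂ := inner ℂ w t with hp
  have hf : (fun ζ : ℂ => -Real.log |Real.log ‖w + ζ • t‖|) = fun z : ℂ => -Real.log (Real.log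
      (‖w‖ ^ 2 + 2 * (z.re * p.re - z.im * p.im) + ‖t‖ ^ 2 * (z.re ^ 2 + z.im ^ 2)) / 2) := by
    funext z
    rw [← norm_add_smul_sq_eq, Real.log_abs, Real.log_pow]
    norm_num
  have hcs : p.re ^ 2 + p.im ^ 2 ≤ ‖w‖ ^ 2 * ‖t‖ ^ 2 := by
    have h := pow_le_pow_left₀ (norm_nonneg _) (norm_inner_le_norm (𝕜 := ℂ) w t) 2
    rw [← hp, Complex.sq_norm, Complex.normSq_apply] at h
    linarith
  rw [hf, lapR, fderiv_fderiv_neg_log_log_quadratic _ _ _ (by positivity) hw1,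
    fderiv_fderiv_neg_log_log_quadratic _ _ _ (by positivity) hw1, Real.log_pow]
  set l := Real.log ‖w‖
  have hl0 : l ≠ 0 := by linarith
  have hdiff : (1 + (2 : ℕ) * l) * (2 * p.re * (1 : ℂ).re - 2 * p.im * (1 : ℂ).im) ^ 2
        / ((2 : ℕ) * l * ‖w‖ ^ 2) ^ 2
      - 2 * ‖t‖ ^ 2 * ((1 : ℂ).re ^ 2 + (1 : ℂ).im ^ 2) / ((2 : ℕ) * l * ‖w‖ ^ 2)
      + ((1 + (2 : ℕ) * l) * (2 * p.re * Complex.I.re - 2 * p.im * Complex.I.im) ^ 2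
        / ((2 : ℕ) * l * ‖w‖ ^ 2) ^ 2
      - 2 * ‖t‖ ^ 2 * (Complex.I.re ^ 2 + Complex.I.im ^ 2) / ((2 : ℕ) * l * ‖w‖ ^ 2))
      - ‖t‖ ^ 2 / (‖w‖ ^ 2 * l ^ 2)
      = (-1 - 2 * l) * (‖w‖ ^ 2 * ‖t‖ ^ 2 - (p.re ^ 2 + p.im ^ 2)) / (l * ‖w‖ ^ 2) ^ 2 := by
    simp
    field_simp
    ring
  rw [← sub_nonneg, hdiff]
  exact div_nonneg (mul_nonneg (by linarith) (by linarith)) (sq_nonneg _)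
end

section
/- (Jensen measures) Let M be a topological space, K ⊆ M a compact Hausdorff subspace, and p ∈ M. Let S be a set of continuous functions M → ℝ that is a convex cone (closed under addition and under multiplication by nonnegative reals) and contains the constant function 1. Assume that for every λ ∈ S, λ(p) ≤ sup_{x ∈ K} λ(x). Then there exists a regular Borel probability measure μ on K such that for every λ ∈ S, λ(p) ≤ ∫_K λ dμ. -/
open MeasureTheory

/-- On a compact Hausdorff space, a positive linear functional on continuous functions that
maps `1` to `1` is integration against a regular probability measure. -/
theorem exists_isProbabilityMeasure_regular_integral_eq {X : Type*} [TopologicalSpace X]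
    [CompactSpace X] [T2Space X] [MeasurableSpace X] [BorelSpace X] (Λ : C(X, ℝ) →ₗ[ℝ] ℝ)
    (hΛ : ∀ f, 0 ≤ f → 0 ≤ Λ f) (hone : Λ 1 = 1) :
    ∃ μ : Measure X, IsProbabilityMeasure μ ∧ μ.Regular ∧ ∀ f : C(X, ℝ), ∫ x, f x ∂μ = Λ f := by
  let L : CompactlySupportedContinuousMap X ℝ →ₗ[ℝ] ℝ :=
    { toFun f := Λ f.toContinuousMap
      map_add' f g := Λ.map_add f.toContinuousMap g.toContinuousMap
      map_smul' c f := Λ.map_smul c f.toContinuousMap }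
  let P := PositiveLinearMap.mk₀ L fun f hf ↦ hΛ f.toContinuousMap hf
  have hint (f : C(X, ℝ)) : ∫ x, f x ∂(RealRMK.rieszMeasure P) = Λ f :=
    RealRMK.integral_rieszMeasure P ⟨f, .of_compactSpace f⟩
  have hreg : (RealRMK.rieszMeasure P).Regular := inferInstance
  refine ⟨RealRMK.rieszMeasure P, ⟨?_⟩, hreg, hint⟩
  have h := hint 1
  simpa [hone, Measure.real, ENNReal.toReal_eq_one_iff] using h

/-- If every element of a convex cone `C` of functions in `C(X, ℝ) × ℝ` takes somewhere on the
compact space `X` a value at least its second coordinate, then some positive normalized linear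
functional on `C(X, ℝ)` dominates the second coordinate on `C`. -/
theorem exists_positive_linearMap_le {X : Type*} [TopologicalSpace X] [CompactSpace X]
    [Nonempty X] (C : PointedCone ℝ (C(X, ℝ) × ℝ)) (hC : ∀ a ∈ C, ∃ x, a.2 ≤ a.1 x) :
    ∃ Λ : C(X, ℝ) →ₗ[ℝ] ℝ, (∀ f, 0 ≤ f → 0 ≤ Λ f) ∧ Λ 1 = 1 ∧ ∀ a ∈ C, a.2 ≤ Λ a.1 := by
  let s : PointedCone ℝ C(X, ℝ) :=
    { carrier := {g | ∃ a ∈ C, ∀ x, a.1 x - a.2 ≤ g x}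
      zero_mem' := ⟨0, C.zero_mem, by simp⟩
      add_mem' := by
        rintro g h ⟨a, ha, hag⟩ ⟨b, hb, hbh⟩
        refine ⟨a + b, C.add_mem ha hb, fun x ↦ ?_⟩
        have h₁ := hag x
        have h₂ := hbh x
        simp only [Prod.fst_add, Prod.snd_add, ContinuousMap.add_apply]
        linarith
      smul_mem' := by
        rintro ⟨c, hc⟩ g ⟨a, ha, hag⟩
        refine ⟨c • a, C.smul_mem hc ha, fun x ↦ ?_⟩
        have h := mul_le_mul_of_nonneg_left (hag x) hc
        change c * a.1 x - c * a.2 ≤ c * g x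
        linarith }
  have hpos {g : C(X, ℝ)} (hg : 0 ≤ g) : g ∈ s := ⟨0, C.zero_mem, by simpa using fun x ↦ hg x⟩
  have hone_ne : (1 : C(X, ℝ)) ≠ 0 := one_ne_zero
  let f : C(X, ℝ) →ₗ.[ℝ] ℝ := LinearPMap.mkSpanSingleton 1 1 hone_ne
  obtain ⟨Λ, hΛf, hΛs⟩ := riesz_extension s f
    (by
      rintro ⟨y, hy⟩ hys
      obtain ⟨c, rfl⟩ := Submodule.mem_span_singleton.1 hy
      obtain ⟨a, ha, hac⟩ := hys
      obtain ⟨x, hx⟩ := hC a ha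
      have h := hac x
      simp only [ContinuousMap.smul_apply, ContinuousMap.one_apply, smul_eq_mul, mul_one] at h
      have hfc : f ⟨c • 1, hy⟩ = c • (1 : ℝ) := LinearPMap.mkSpanSingleton'_apply _ _ _ _ _
      rw [hfc, smul_eq_mul, mul_one]
      linarith)
    (fun y ↦ ⟨⟨‖y‖ • 1, Submodule.mem_span_singleton.2 ⟨_, rfl⟩⟩, hpos fun x ↦ by
      have h := neg_le_of_abs_le (y.norm_coe_le_norm x)
      change 0 ≤ ‖y‖ * 1 + y x
      linarith⟩)
  have hΛone : Λ 1 = 1 := by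
    rw [hΛf ⟨1, Submodule.mem_span_singleton_self _⟩]
    exact LinearPMap.mkSpanSingleton'_apply_self _ _ _ _
  refine ⟨Λ, fun g hg ↦ hΛs g (hpos hg), hΛone, fun a ha ↦ ?_⟩
  have h := hΛs (a.1 - a.2 • 1) ⟨a, ha, by simp⟩
  rw [map_sub, map_smul, hΛone, smul_eq_mul, mul_one] at h
  linarith

/-- (Jensen measures) Let `K` be a compact subset of a topological space `M` whose subspace
topology is Hausdorff, let `p ∈ M`, and let `S` be a convex cone of continuous real functions
on `M` containing the constant `1`, such that `λ(p) ≤ sup_K λ` for every `λ ∈ S`. Then there is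
a regular Borel probability measure `μ` on `K` with `λ(p) ≤ ∫_K λ dμ` for every `λ ∈ S`. -/
theorem stmt17 {M : Type*} [TopologicalSpace M] [MeasurableSpace M] [BorelSpace M]
    (K : Set M) (hK : IsCompact K) [T2Space ↥K] (p : M)
    (S : Set C(M, ℝ))
    (hadd : ∀ f ∈ S, ∀ g ∈ S, f + g ∈ S)
    (hsmul : ∀ c : ℝ, 0 ≤ c → ∀ f ∈ S, c • f ∈ S)
    (hone : (1 : C(M, ℝ)) ∈ S)
    (hsup : ∀ f ∈ S, f p ≤ sSup (f '' K)) :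
    ∃ μ : Measure ↥K, IsProbabilityMeasure μ ∧ μ.Regular ∧
      ∀ f ∈ S, f p ≤ ∫ x : ↥K, f ↑x ∂μ := by
  have hne : K.Nonempty := by
    rw [Set.nonempty_iff_ne_empty]
    rintro rfl
    have h := hsup 1 hone
    norm_num at h
  have : Nonempty K := hne.to_subtype
  have : CompactSpace K := isCompact_iff_compactSpace.1 hK
  let C : PointedCone ℝ (C(K, ℝ) × ℝ) :=
    { carrier := {a | ∃ f ∈ S, (f.restrict K, f p) = a}
      zero_mem' := ⟨0, by simpa using hsmul 0 le_rfl 1 hone, rfl⟩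
      add_mem' := by
        rintro _ _ ⟨f, hf, rfl⟩ ⟨g, hg, rfl⟩
        exact ⟨f + g, hadd f hf g hg, rfl⟩
      smul_mem' := by
        rintro ⟨c, hc⟩ _ ⟨f, hf, rfl⟩
        exact ⟨c • f, hsmul c hc f hf, rfl⟩ }
  obtain ⟨Λ, hΛ, hΛone, hΛC⟩ := exists_positive_linearMap_le C (by
    rintro _ ⟨f, hf, rfl⟩
    obtain ⟨x, hx, hfx⟩ := hK.exists_sSup_image_eq hne f.continuous.continuousOn
    exact ⟨⟨x, hx⟩, (hsup f hf).trans_eq hfx⟩)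
  obtain ⟨μ, hμ, hreg, hint⟩ := exists_isProbabilityMeasure_regular_integral_eq Λ hΛ hΛone
  exact ⟨μ, hμ, hreg, fun f hf ↦ (hΛC _ ⟨f, hf, rfl⟩).trans_eq (hint (f.restrict K)).symm⟩
end
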